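/- For every k ≥ 2, the localization numbers satisfy 𝔏_{k+1} ≤ 𝔏_k. -/

import Mathlib

/-- A tree: a set of finite sequences of naturals closed under initial segments. -/
def IsTree (T : Set (List ℕ)) : Prop :=
  ∀ σ ∈ T, ∀ n : ℕ, σ.take n ∈ T

/-- The immediate successors of a node `σ` within `T`. -/
def succs (T : Set (List ℕ)) (σ : List ℕ) : Set ℕ :=
  {m : ℕ | σ ++ [m] ∈ T}

/-- A `k`-tree: a tree in which every node has at least `1` and at most `k`
immediate successors. -/
def IsKTree (k : ℕ) (T : Set (List ℕ)) : Prop :=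
  IsTree T ∧ ∀ σ ∈ T, 1 ≤ (succs T σ).encard ∧ (succs T σ).encard ≤ k

/-- The initial segment `f↾n = ⟨f 0, …, f (n-1)⟩`. -/
def seg (f : ℕ → ℕ) (n : ℕ) : List ℕ :=
  List.ofFn fun i : Fin n => f i

/-- `f` is a branch of `T` if all its finite initial segments belong to `T`. -/
def IsBranch (T : Set (List ℕ)) (f : ℕ → ℕ) : Prop :=
  ∀ n : ℕ, seg f n ∈ T

/-- A `k`-branching tree: a tree in which every node has either exactly `1` or
exactly `k` immediate successors. -/
def IsKBranching (k : ℕ) (T : Set (List ℕ)) : Prop :=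
  IsTree T ∧ ∀ σ ∈ T, (succs T σ).encard = 1 ∨ (succs T σ).encard = k

/-- The `k`-localization number `𝔏_k`: the smallest cardinality of a family of
`k`-branching trees such that every `f : ℕ → {0,…,k}` is a branch of one of them. -/
noncomputable def locNum (k : ℕ) : Cardinal :=
  sInf {c : Cardinal | ∃ 𝒯 : Set (Set (List ℕ)), Cardinal.mk 𝒯 = c ∧
    (∀ T ∈ 𝒯, IsKBranching k T) ∧
    ∀ f : ℕ → ℕ, (∀ n, f n ≤ k) → ∃ T ∈ 𝒯, IsBranch T f}

/-- The tree in which the immediate successors of each node `σ` are the elements of `A σ`. -/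
def treeOf (A : List ℕ → Set ℕ) : Set (List ℕ) :=
  {σ | ∀ τ m, τ ++ [m] <+: σ → m ∈ A τ}

lemma isTree_treeOf (A : List ℕ → Set ℕ) : IsTree (treeOf A) :=
  fun σ hσ n τ m h => hσ τ m (h.trans (σ.take_prefix n))

lemma succs_treeOf {A : List ℕ → Set ℕ} {σ : List ℕ} (hσ : σ ∈ treeOf A) :
    succs (treeOf A) σ = A σ := by
  ext m
  refine ⟨fun h => h σ m (List.prefix_refl _), fun hm τ n h => ?_⟩
  rcases List.prefix_concat_iff.1 h with h | h
  · obtain ⟨rfl, h⟩ := List.append_inj' h rfl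
    simp_all
  · exact hσ τ n h

lemma isKBranching_treeOf {k : ℕ} {A : List ℕ → Set ℕ}
    (hA : ∀ σ, (A σ).encard = 1 ∨ (A σ).encard = k) : IsKBranching k (treeOf A) :=
  ⟨isTree_treeOf A, fun σ hσ => by rw [succs_treeOf hσ]; exact hA σ⟩

lemma seg_succ (f : ℕ → ℕ) (n : ℕ) : seg f (n + 1) = seg f n ++ [f n] := by
  simp only [seg, List.ofFn_succ_last, Fin.val_castSucc, Fin.val_last]

lemma map_seg (g f : ℕ → ℕ) (n : ℕ) : (seg f n).map g = seg (g ∘ f) n := by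
  simp [seg, List.map_ofFn, Function.comp_def]

lemma isBranch_treeOf {A : List ℕ → Set ℕ} {f : ℕ → ℕ} (h : ∀ n, f n ∈ A (seg f n)) :
    IsBranch (treeOf A) f := by
  intro n
  induction n with
  | zero => intro τ m h; simp [seg] at h
  | succ n ih =>
    have hn := h n
    rwa [← succs_treeOf ih, succs, Set.mem_ofPred_eq, ← seg_succ] at hn

/-- The map `ℕ → ℕ` identifying `k` with `k + 1`. -/
def collapse (k m : ℕ) : ℕ := if m ≤ k then m else m - 1

lemma encard_preimage_collapse_le (k : ℕ) (s : Set ℕ) :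
    (collapse k ⁻¹' s).encard ≤ s.encard + 1 := by
  have hsub : collapse k ⁻¹' s ⊆ insert (k + 1) ((collapse k ⁻¹' s) \ {k + 1}) := by
    intro m hm
    by_cases h : m = k + 1 <;> simp_all
  have hinj : Set.InjOn (collapse k) ((collapse k ⁻¹' s) \ {k + 1}) := by
    intro a ha b hb hab
    have ha' : a ≠ k + 1 := ha.2
    have hb' : b ≠ k + 1 := hb.2
    unfold collapse at hab
    split_ifs at hab <;> omega
  have himage : collapse k '' ((collapse k ⁻¹' s) \ {k + 1}) ⊆ s := by
    rintro _ ⟨m, hm, rfl⟩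
    exact hm.1
  calc (collapse k ⁻¹' s).encard
      ≤ ((collapse k ⁻¹' s) \ {k + 1}).encard + 1 :=
        (Set.encard_le_encard hsub).trans (Set.encard_insert_le _ _)
    _ ≤ s.encard + 1 := by
        rw [← hinj.encard_image]
        gcongr

/-- Every `k`-branching tree `T` yields a `(k+1)`-branching tree through all functions whose
collapse is a branch of `T`. -/
lemma exists_isKBranching_succ {k : ℕ} (hk : 1 ≤ k) {T : Set (List ℕ)} (hT : IsKBranching k T) :
    ∃ S, IsKBranching (k + 1) S ∧ ∀ f : ℕ → ℕ, IsBranch T (collapse k ∘ f) → IsBranch S f := by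
  have key : ∀ σ : List ℕ, ∃ A : Set ℕ, A.encard = ((k + 1 : ℕ) : ℕ∞) ∧
      (σ.map (collapse k) ∈ T → collapse k ⁻¹' succs T (σ.map (collapse k)) ⊆ A) := by
    intro σ
    by_cases hσ : σ.map (collapse k) ∈ T
    · have hle : (succs T (σ.map (collapse k))).encard ≤ k := by
        rcases hT.2 _ hσ with h | h
        · rw [h]; exact_mod_cast hk
        · exact h.le
      have hcard : (collapse k ⁻¹' succs T (σ.map (collapse k))).encard ≤ ((k + 1 : ℕ) : ℕ∞) := by
        refine (encard_preimage_collapse_le k _).trans ?_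
        push_cast
        gcongr
      obtain ⟨A, hA, -, hA'⟩ := Set.exists_superset_subset_encard_eq (Set.subset_univ _) hcard
        (by simp [Set.infinite_univ.encard_eq])
      exact ⟨A, hA', fun _ => hA⟩
    · exact ⟨Finset.range (k + 1), by rw [Set.encard_coe_eq_coe_finsetCard, Finset.card_range],
         fun h => absurd h hσ⟩
  choose A hA hsub using key
  refine ⟨treeOf A, isKBranching_treeOf fun σ => Or.inr (hA σ), fun f hf => ?_⟩
  refine isBranch_treeOf fun n => hsub _ ?_ ?_
  · rw [map_seg]
    exact hf n
  · have h := hf (n + 1)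
    rw [seg_succ] at h
    rwa [Set.mem_preimage, map_seg]

lemma exists_cover (k : ℕ) : ∃ 𝒯 : Set (Set (List ℕ)), (∀ T ∈ 𝒯, IsKBranching k T) ∧
    ∀ f : ℕ → ℕ, (∀ n, f n ≤ k) → ∃ T ∈ 𝒯, IsBranch T f := by
  refine ⟨Set.range fun f : ℕ → ℕ => treeOf fun σ => {f σ.length}, ?_, fun f _ => ⟨_, ⟨f, rfl⟩, ?_⟩⟩
  · rintro _ ⟨f, rfl⟩
    exact isKBranching_treeOf fun σ => Or.inl (Set.encard_singleton _)
  · exact isBranch_treeOf fun n => by simp [seg]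

theorem stmt10 (k : ℕ) (hk : 2 ≤ k) : locNum (k + 1) ≤ locNum k := by
  have hne : {c : Cardinal | ∃ 𝒯 : Set (Set (List ℕ)), Cardinal.mk 𝒯 = c ∧
      (∀ T ∈ 𝒯, IsKBranching k T) ∧
      ∀ f : ℕ → ℕ, (∀ n, f n ≤ k) → ∃ T ∈ 𝒯, IsBranch T f}.Nonempty := by
    obtain ⟨𝒯, h⟩ := exists_cover k
    exact ⟨_, 𝒯, rfl, h⟩
  obtain ⟨𝒯, hcard, hbranching, hcover⟩ := csInf_mem hne
  choose! S hS hSbranch using fun T (hT : T ∈ 𝒯) =>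
    exists_isKBranching_succ (one_le_two.trans hk) (hbranching T hT)
  calc locNum (k + 1) ≤ Cardinal.mk (S '' 𝒯) := by
        refine csInf_le' ⟨S '' 𝒯, rfl, ?_, fun f hf => ?_⟩
        · rintro _ ⟨T, hT, rfl⟩
          exact hS T hT
        · obtain ⟨T, hT, hTf⟩ := hcover (collapse k ∘ f) fun n => by
            have := hf n
            simp only [Function.comp_apply, collapse]
            split_ifs <;> omega
          exact ⟨S T, ⟨T, hT, rfl⟩, hSbranch T hT f hTf⟩
    _ ≤ Cardinal.mk 𝒯 := Cardinal.mk_image_le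
    _ = locNum k := hcard
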